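/- arXiv:0711.0312 — 2 statements merged into one kernel-verified Lean document; each statement's English description precedes it below -/
import Mathlib

section
/- Define c_d = ((κ_d − 1)/d) · e^{−d} · Σ_{k=0}^{d−1} d^k/k!. Then c_d = 1/√(2πd) + O(1/d) as d → ∞. -/
open scoped Classical
open Function

namespace IterMap

noncomputable section

/-- A vertex `v` is cyclic for `f` if some positive iterate of `f` fixes `v`. -/
def IsCyclic {n : ℕ} (f : Fin n → Fin n) (v : Fin n) : Prop :=
  ∃ t, 0 < t ∧ f^[t] v = v

theorem isCyclic_apply {n : ℕ} {f : Fin n → Fin n} {v : Fin n} (h : IsCyclic f v) :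
    IsCyclic f (f v) := by
  obtain ⟨t, ht, hv⟩ := h
  refine ⟨t, ht, ?_⟩
  calc f^[t] (f v) = f^[t + 1] v := (Function.iterate_succ_apply f t v).symm
    _ = f (f^[t] v) := Function.iterate_succ_apply' f t v
    _ = f v := by rw [hv]

/-- The permutation induced by `f` on its cyclic vertices. -/
def cyclicPerm {n : ℕ} (f : Fin n → Fin n) :
    Equiv.Perm {v : Fin n // IsCyclic f v} :=
  Equiv.ofBijective (fun v => ⟨f v.1, isCyclic_apply v.2⟩) (by
    rw [← Finite.injective_iff_bijective]
    intro u v huv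
    have h1 : f u.1 = f v.1 := congrArg Subtype.val huv
    obtain ⟨s, hs, hsu⟩ := u.2
    obtain ⟨t, ht, htv⟩ := v.2
    have hu : f^[s * t] u.1 = u.1 := by
      rw [Function.iterate_mul]
      exact Function.iterate_fixed hsu t
    have hv : f^[s * t] v.1 = v.1 := by
      rw [mul_comm, Function.iterate_mul]
      exact Function.iterate_fixed htv s
    have hst : 0 < s * t := Nat.mul_pos hs ht
    obtain ⟨k, hk⟩ : ∃ k, s * t = k + 1 := ⟨s * t - 1, by omega⟩
    apply Subtype.ext
    calc u.1 = f^[s * t] u.1 := hu.symm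
      _ = f^[k] (f u.1) := by rw [hk, Function.iterate_succ_apply]
      _ = f^[k] (f v.1) := by rw [h1]
      _ = f^[s * t] v.1 := by rw [hk, Function.iterate_succ_apply]
      _ = v.1 := hv)

/-- `T f`: the (eventual) period of the sequence of iterates of `f`. -/
def T {n : ℕ} (f : Fin n → Fin n) : ℕ :=
  sInf {T : ℕ | 0 < T ∧ ∀ m, n ≤ m → f^[m + T] = f^[m]}

/-- `B f`: the product of the lengths of the cycles of `f`. -/
def B {n : ℕ} (f : Fin n → Fin n) : ℕ :=
  (cyclicPerm f).cycleType.prod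

/-- `Z f`: the number of cyclic vertices of `f`. -/
def Z {n : ℕ} (f : Fin n → Fin n) : ℕ :=
  Nat.card {v : Fin n // IsCyclic f v}

/-- `O f`: the number of distinct positive iterates of `f`. -/
def O {n : ℕ} (f : Fin n → Fin n) : ℕ :=
  Nat.card {g : Fin n → Fin n // ∃ t, 0 < t ∧ g = f^[t]}

/-- `f` is connected if its functional graph has one weak component. -/
def Connected {n : ℕ} (f : Fin n → Fin n) : Prop :=
  ∀ u v : Fin n, ∃ s t : ℕ, f^[s] u = f^[t] v

/-- The set of connected mappings on `[n]`. -/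
def Un (n : ℕ) : Finset (Fin n → Fin n) :=
  Finset.univ.filter fun f => Connected f

/-- `kappa n`: the average cycle length of a uniform random connected mapping. -/
def kappa (n : ℕ) : ℝ :=
  (∑ f ∈ Un n, (Z f : ℝ)) / (Un n).card

def c (d : ℕ) : ℝ :=
  ((kappa d - 1) / d) * Real.exp (-(d : ℝ)) *
    ∑ k ∈ Finset.range d, (d : ℝ) ^ k / (k.factorial : ℝ)

def F (z : ℝ) : ℝ := (1 / (1 - z)) * Real.exp (∑' d : ℕ, c d * z ^ d)

def mu (m : ℕ) : ℝ := iteratedDeriv m F 0 / (m.factorial : ℝ)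

def g (s : ℝ) : ℝ := ∑' d : ℕ, c d * Real.exp (-(d : ℝ) * s)

/-- `M m`: the average order of a uniform random permutation of `[m]`. -/
def M (m : ℕ) : ℝ :=
  (∑ σ : Equiv.Perm (Fin m), (orderOf σ : ℝ)) / (m.factorial : ℝ)

def I : ℝ :=
  ∫ t in Set.Ioi (0 : ℝ), Real.log (Real.log (Real.exp 1 / (1 - Real.exp (-t))))

def beta0 : ℝ := Real.sqrt (8 * I)

def k0 : ℝ := (3 / 2) * (3 * I) ^ ((2 : ℝ) / 3)

end

/-- `f` is in `XR R` iff every vertex reaches `R`. -/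
def XR {d : ℕ} (R : Finset (Fin d)) (f : Fin d → Fin d) : Prop :=
  ∀ u, ∃ s, f^[s] u ∈ R

/-- the first return of `a` to `R` is `r`. -/
def Hit {d : ℕ} (R : Finset (Fin d)) (a : Fin d) (f : Fin d → Fin d) (r : Fin d) : Prop :=
  ∃ n, f^[n + 1] a = r ∧ ∀ m < n, f^[m + 1] a ∉ R

theorem swap_iter {d : ℕ} {R : Finset (Fin d)} {a b : Fin d} (ha : a ∈ R) (hb : b ∈ R)
    (f : Fin d → Fin d) (u : Fin d) (n : ℕ) (h : ∀ m < n, f^[m + 1] u ∉ R) :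
    (Equiv.swap a b ∘ f)^[n + 1] u = Equiv.swap a b (f^[n + 1] u) := by
  induction n with
  | zero => rfl
  | succ n ih =>
    rw [Function.iterate_succ_apply', ih (fun m hm => h m (by omega)),
      Function.iterate_succ_apply' f (n+1)]
    have := h n (by omega)
    rw [Equiv.swap_apply_of_ne_of_ne (x := f^[n+1] u)]
    · rfl
    · rintro h'; exact this (h' ▸ ha)
    · rintro h'; exact this (h' ▸ hb)

theorem swap_mem {d : ℕ} {R : Finset (Fin d)} {a b : Fin d} (ha : a ∈ R) (hb : b ∈ R)
    (x : Fin d) : Equiv.swap a b x ∈ R ↔ x ∈ R := by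
  rw [Equiv.swap_apply_def]; split_ifs <;> simp_all

theorem first_hit {d : ℕ} {R : Finset (Fin d)} {f : Fin d → Fin d} (h : XR R f) (u : Fin d) :
    ∃ n, f^[n + 1] u ∈ R ∧ ∀ m < n, f^[m + 1] u ∉ R := by
  have hx : ∃ n, f^[n + 1] u ∈ R := by
    obtain ⟨s, hs⟩ := h (f u)
    exact ⟨s, by rwa [Function.iterate_succ_apply]⟩
  exact ⟨Nat.find hx, Nat.find_spec hx, fun m hm => Nat.find_min hx hm⟩

theorem swap_XR {d : ℕ} {R : Finset (Fin d)} {a b : Fin d} (ha : a ∈ R) (hb : b ∈ R)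
    {f : Fin d → Fin d} (h : XR R f) : XR R (Equiv.swap a b ∘ f) := by
  intro u
  obtain ⟨n, hn, hm⟩ := first_hit h u
  exact ⟨n + 1, by rw [swap_iter ha hb f u n hm, swap_mem ha hb]; exact hn⟩

theorem swap_Hit {d : ℕ} {R : Finset (Fin d)} {a b : Fin d} (ha : a ∈ R) (hb : b ∈ R) (u : Fin d)
    {f : Fin d → Fin d} (h : Hit R u f a) : Hit R u (Equiv.swap a b ∘ f) b := by
  obtain ⟨n, hn, hm⟩ := h
  refine ⟨n, ?_, ?_⟩
  · rw [swap_iter ha hb f u n hm, hn, Equiv.swap_apply_left]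
  · intro m hmn
    rw [swap_iter ha hb f u m (fun k hk => hm k (by omega)), swap_mem ha hb]
    exact hm m hmn

theorem Hit_card_le {d : ℕ} {R : Finset (Fin d)} {a b : Fin d} (ha : a ∈ R) (hb : b ∈ R)
    (u : Fin d) :
    (Finset.univ.filter fun f : Fin d → Fin d => XR R f ∧ Hit R u f a).card ≤
    (Finset.univ.filter fun f : Fin d → Fin d => XR R f ∧ Hit R u f b).card := by
  refine Finset.card_le_card_of_injOn (fun f => Equiv.swap a b ∘ f) ?_ ?_
  · intro f hf
    simp only [Finset.coe_filter, Finset.mem_univ, true_and, Set.mem_ofPred_eq] at hf ⊢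
    exact ⟨swap_XR ha hb hf.1, swap_Hit ha hb u hf.2⟩
  · intro f _ g _ hfg
    funext x
    exact (Equiv.swap a b).injective (congrFun hfg x)

theorem Hit_sum {d : ℕ} (R : Finset (Fin d)) (u : Fin d) :
    (Finset.univ.filter fun f : Fin d → Fin d => XR R f).card =
    ∑ r ∈ R, (Finset.univ.filter fun f : Fin d → Fin d => XR R f ∧ Hit R u f r).card := by
  rw [← Finset.card_biUnion]
  · congr 1
    ext f
    simp only [Finset.mem_filter, Finset.mem_univ, true_and, Finset.mem_biUnion]
    constructor
    · intro h
      obtain ⟨n, hn, hm⟩ := first_hit h u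
      exact ⟨_, hn, h, n, rfl, hm⟩
    · rintro ⟨_, _, h, _⟩; exact h
  · intro r hr r' hr' hne
    rw [Function.onFun, Finset.disjoint_left]
    intro f h1 h2
    simp only [Finset.mem_filter, Finset.mem_univ, true_and] at h1 h2
    obtain ⟨_, n, hn, hm⟩ := h1
    obtain ⟨_, n', hn', hm'⟩ := h2
    rcases lt_trichotomy n n' with h | h | h
    · exact hm' n h (hn ▸ hr)
    · subst h; exact hne (hn.symm.trans hn')
    · exact hm n' h (hn' ▸ hr')

theorem XR_insert {d : ℕ} {R : Finset (Fin d)} {a : Fin d} (ha : a ∉ R) (f : Fin d → Fin d) :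
    XR R f ↔ XR (insert a R) f ∧ ¬ Hit (insert a R) a f a := by
  constructor
  · intro h
    refine ⟨fun u => (h u).imp fun s hs => Finset.mem_insert_of_mem hs, ?_⟩
    rintro ⟨n, hn, hm⟩
    obtain ⟨s, hs⟩ := h a
    have hp : IsPeriodicPt f (n + 1) a := hn
    rw [← hp.iterate_mod_apply] at hs
    have hlt := Nat.mod_lt s (Nat.succ_pos n)
    rcases Nat.eq_zero_or_pos (s % (n + 1)) with h0 | h0
    · rw [h0] at hs; exact ha hs
    · apply hm (s % (n + 1) - 1) (by simp only [Nat.succ_eq_add_one] at hlt; omega)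
      rw [Nat.sub_add_cancel h0]
      exact Finset.mem_insert_of_mem hs
  · rintro ⟨h, hH⟩ u
    obtain ⟨s, hs⟩ := h u
    rcases Finset.mem_insert.1 hs with hs | hs
    · obtain ⟨n, hn, hm⟩ := first_hit h a
      rcases Finset.mem_insert.1 hn with hn | hn
      · exact absurd ⟨n, hn, hm⟩ hH
      · exact ⟨n + 1 + s, by rw [Function.iterate_add_apply, hs]; exact hn⟩
    · exact ⟨s, hs⟩

theorem XR_step {d : ℕ} {R : Finset (Fin d)} {a : Fin d} (ha : a ∉ R) :
    (Finset.univ.filter fun f : Fin d → Fin d => XR R f).card * (R.card + 1) =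
    (Finset.univ.filter fun f : Fin d → Fin d => XR (insert a R) f).card * R.card := by
  have h1 := Hit_sum (insert a R) a
  have haR := Finset.mem_insert_self a R
  rw [Finset.sum_congr rfl (g := fun _ => (Finset.univ.filter fun f : Fin d → Fin d =>
    XR (insert a R) f ∧ Hit (insert a R) a f a).card)
    (fun r hr => le_antisymm (Hit_card_le hr haR a) (Hit_card_le haR hr a))] at h1
  rw [Finset.sum_const, Finset.card_insert_of_notMem ha, smul_eq_mul] at h1
  have h2 := Finset.card_filter_add_card_filter_not (s := Finset.univ.filter
    fun f : Fin d → Fin d => XR (insert a R) f) (fun f => Hit (insert a R) a f a)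
  rw [Finset.filter_filter, Finset.filter_filter] at h2
  simp_rw [← XR_insert ha] at h2
  set x := (Finset.univ.filter fun f : Fin d → Fin d =>
    XR (insert a R) f ∧ Hit (insert a R) a f a).card
  set y := (Finset.univ.filter fun f : Fin d → Fin d => XR (insert a R) f).card
  set z := (Finset.univ.filter fun f : Fin d → Fin d => XR R f).card
  have h3 : z = R.card * x := by nlinarith
  rw [h3, h1]; ring

theorem XR_card {d : ℕ} (R : Finset (Fin d)) :
    (Finset.univ.filter fun f : Fin d → Fin d => XR R f).card * d = d ^ d * R.card := by
  induction hk : Rᶜ.card using Nat.strong_induction_on generalizing R with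
  | _ k ih =>
    by_cases hR : R = Finset.univ
    · subst hR
      rw [Finset.filter_true_of_mem]
      · simp
      · intro f _ u; exact ⟨0, Finset.mem_univ _⟩
    · obtain ⟨a, ha⟩ : ∃ a, a ∉ R := by
        by_contra! h; exact hR (Finset.eq_univ_iff_forall.2 h)
      have := ih (insert a R)ᶜ.card (by
        rw [← hk]; apply Finset.card_lt_card
        rw [Finset.compl_ssubset_compl]; exact Finset.ssubset_insert ha) (insert a R) rfl
      have h2 := XR_step ha
      rw [Finset.card_insert_of_notMem ha] at this
      apply Nat.eq_of_mul_eq_mul_right (Nat.succ_pos R.card)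
      rw [Nat.succ_eq_add_one]
      calc _ = ((Finset.univ.filter fun f : Fin d → Fin d => XR R f).card * (R.card + 1)) * d := by ring
        _ = _ := by rw [h2]; linear_combination R.card * this

theorem fix_one {d : ℕ} (P : (Fin d → Fin d) → Prop) (c w : Fin d)
    (hP : ∀ f x, P f → P (Function.update f c x)) :
    (Finset.univ.filter fun f => P f).card =
      d * (Finset.univ.filter fun f => P f ∧ f c = w).card := by
  rw [Finset.card_eq_sum_card_fiberwise (f := fun f => f c) (t := Finset.univ) (by simp)]
  rw [Finset.sum_congr rfl (g := fun _ => (Finset.univ.filter fun f => P f ∧ f c = w).card)]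
  · simp
  · intro x _
    rw [Finset.filter_filter]
    refine Finset.card_nbij' (fun f => Function.update f c w) (fun f => Function.update f c x)
      ?_ ?_ ?_ ?_
    · intro f; simp; intro h _; exact hP f _ h
    · intro f; simp; intro h _; exact hP f _ h
    · intro f; simp; rintro h rfl; simp
    · intro f; simp; rintro h rfl; simp

theorem fix_many {d : ℕ} (C : Finset (Fin d)) (P : (Fin d → Fin d) → Prop) (w : Fin d → Fin d)
    (hP : ∀ f, ∀ c ∈ C, ∀ x, P f → P (Function.update f c x)) :
    (Finset.univ.filter fun f => P f).card =
      d ^ C.card * (Finset.univ.filter fun f => P f ∧ ∀ c ∈ C, f c = w c).card := by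
  induction C using Finset.induction_on with
  | empty => simp
  | insert a C ha ih =>
    rw [ih (fun f c hc => hP f c (Finset.mem_insert_of_mem hc)), Finset.card_insert_of_notMem ha,
      pow_succ, mul_assoc]
    congr 1
    have key : (Finset.univ.filter fun f => P f ∧ ∀ c ∈ insert a C, f c = w c) =
        (Finset.univ.filter fun f => (P f ∧ ∀ c ∈ C, f c = w c) ∧ f a = w a) := by
      ext f
      simp only [Finset.mem_filter, Finset.mem_univ, true_and, Finset.forall_mem_insert]
      tauto
    rw [key]
    have h1 := fix_one (fun f => P f ∧ ∀ c ∈ C, f c = w c) a (w a) ?_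
    · convert h1
    · rintro f x ⟨h1, h2⟩
      refine ⟨hP f a (Finset.mem_insert_self _ _) x h1, fun c hc => ?_⟩
      have hca : c ≠ a := by
        rintro rfl
        exact ha hc
      rw [Function.update_of_ne hca]
      exact h2 c hc

theorem XR_update {d : ℕ} {R : Finset (Fin d)} {f : Fin d → Fin d} {c : Fin d} (hc : c ∈ R)
    (x : Fin d) (h : XR R f) : XR R (Function.update f c x) := by
  intro u
  obtain ⟨s, hs⟩ := h u
  induction s generalizing u with
  | zero => exact ⟨0, hs⟩
  | succ s ih =>
    by_cases hu : u = c
    · exact ⟨0, hu ▸ hc⟩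
    · rw [Function.iterate_succ_apply] at hs
      obtain ⟨t, ht⟩ := ih _ hs
      exact ⟨t + 1, by rw [Function.iterate_succ_apply, Function.update_of_ne hu]; exact ht⟩

theorem follow_card {d k : ℕ} (e : Fin (k + 1) ↪ Fin d) :
    (Finset.univ.filter fun f : Fin d → Fin d => XR (Finset.univ.map e) f ∧
      ∀ i, f (e i) = e (i + 1)).card * (d ^ (k + 1) * d) = d ^ d * (k + 1) := by
  have h1 := fix_many (Finset.univ.map e) (fun f => XR (Finset.univ.map e) f)
    (fun v => e (Function.invFun e v + 1)) (fun f c hc x h => XR_update hc x h)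
  have h2 := XR_card (Finset.univ.map e)
  rw [h1] at h2
  simp only [Finset.card_map, Finset.card_univ, Fintype.card_fin] at h2
  have key : (Finset.univ.filter fun f : Fin d → Fin d => XR (Finset.univ.map e) f ∧
      ∀ i, f (e i) = e (i + 1)) = (Finset.univ.filter fun f : Fin d → Fin d =>
      XR (Finset.univ.map e) f ∧ ∀ c ∈ Finset.univ.map e, f c = e (Function.invFun e c + 1)) := by
    ext f
    simp [Function.leftInverse_invFun e.injective _]
  rw [← h2, key]
  ring

theorem conn_iff {d : ℕ} {f : Fin d → Fin d} {v : Fin d} :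
    XR {v} f ↔ Connected f ∧ IsCyclic f v := by
  constructor
  · intro h
    constructor
    · intro u w
      obtain ⟨s, hs⟩ := h u
      obtain ⟨t, ht⟩ := h w
      simp only [Finset.mem_singleton] at hs ht
      exact ⟨s, t, hs.trans ht.symm⟩
    · obtain ⟨s, hs⟩ := h (f v)
      exact ⟨s + 1, Nat.succ_pos _, by simpa using hs⟩
  · rintro ⟨h, t, ht, hv⟩ u
    obtain ⟨a, b, hab⟩ := h u v
    have hp : IsPeriodicPt f t v := hv
    refine ⟨(t * b - b) + a, ?_⟩
    rw [Function.iterate_add_apply, hab, ← Function.iterate_add_apply,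
      Nat.sub_add_cancel (Nat.le_mul_of_pos_left b ht), Finset.mem_singleton]
    exact hp.mul_const b

theorem Z_eq {d : ℕ} {f : Fin d → Fin d} {v : Fin d} (h : XR {v} f) :
    Z f = minimalPeriod f v := by
  have hc := (conn_iff.1 h).2
  obtain ⟨t, ht, hv⟩ := hc
  have hpos : 0 < minimalPeriod f v := IsPeriodicPt.minimalPeriod_pos ht hv
  have : Finset.univ.filter (fun u => IsCyclic f u) =
      (Finset.range (minimalPeriod f v)).image (fun i => f^[i] v) := by
    ext u
    simp only [Finset.mem_filter, Finset.mem_univ, true_and, Finset.mem_image, Finset.mem_range]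
    constructor
    · rintro ⟨s, hs, hu⟩
      obtain ⟨a, ha⟩ := h u
      rw [Finset.mem_singleton] at ha
      have hp : IsPeriodicPt f s u := hu
      refine ⟨(s * a - a) % minimalPeriod f v, Nat.mod_lt _ hpos, ?_⟩
      rw [iterate_mod_minimalPeriod_eq]
      rw [← ha, ← Function.iterate_add_apply, Nat.sub_add_cancel (Nat.le_mul_of_pos_left a hs)]
      exact hp.mul_const a
    · rintro ⟨i, _, rfl⟩
      have hp : IsPeriodicPt f t v := hv
      exact ⟨t, ht, hp.apply_iterate i⟩
  rw [Z, Nat.card_eq_fintype_card, Fintype.card_subtype, this, Finset.card_image_of_injOn,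
    Finset.card_range]
  intro i hi j hj hij
  exact iterate_injOn_Iio_minimalPeriod (by simpa using hi) (by simpa using hj) hij

theorem sum_Z (d : ℕ) (hd : 0 < d) : ∑ f ∈ Un d, Z f = d ^ d := by
  have h : ∀ f : Fin d → Fin d, Z f = ∑ v, if IsCyclic f v then 1 else 0 := by
    intro f
    rw [Z, Nat.card_eq_fintype_card, Fintype.card_subtype, Finset.card_filter]
  simp_rw [h]
  rw [Finset.sum_comm]
  apply Nat.eq_of_mul_eq_mul_right hd
  rw [Finset.sum_mul]
  rw [Finset.sum_congr rfl (g := fun _ => d ^ d)]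
  · simp [mul_comm]
  · intro v _
    have := XR_card ({v} : Finset (Fin d))
    rw [Finset.card_singleton, mul_one] at this
    rw [← this, Un, ← Finset.card_filter, Finset.filter_filter]
    simp_rw [conn_iff]

theorem follow_iter {d k : ℕ} {e : Fin (k + 1) ↪ Fin d} {f : Fin d → Fin d}
    (h : ∀ i, f (e i) = e (i + 1)) (n : ℕ) : f^[n] (e 0) = e (Fin.ofNat (k + 1) n) := by
  induction n with
  | zero => simp
  | succ n ih =>
    rw [Function.iterate_succ_apply', ih, h]
    congr 1
    apply Fin.ext
    simp [Fin.val_add, Fin.ofNat]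

theorem pair_card (d k : ℕ) :
    (Finset.univ.filter fun p : (Fin d → Fin d) × Fin d => XR {p.2} p.1 ∧ Z p.1 = k + 1).card =
    (Finset.univ.filter fun p : (Fin d → Fin d) × (Fin (k + 1) ↪ Fin d) =>
      XR (Finset.univ.map p.2) p.1 ∧ ∀ i, p.1 (p.2 i) = p.2 (i + 1)).card := by
  symm
  refine Finset.card_bij (fun p _ => (p.1, p.2 0)) ?_ ?_ ?_
  · rintro ⟨f, e⟩ h
    simp only [Finset.mem_filter, Finset.mem_univ, true_and] at h ⊢
    obtain ⟨h1, h2⟩ := h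
    have hit := follow_iter h2
    have hX : XR {e 0} f := by
      intro u
      obtain ⟨s, hs⟩ := h1 u
      obtain ⟨i, -, hi⟩ := Finset.mem_map.1 hs
      have : e i = f^[i] (e 0) := by rw [hit]; simp
      refine ⟨(k + 1 - i) + s, ?_⟩
      rw [Function.iterate_add_apply, ← hi, this, ← Function.iterate_add_apply,
        Nat.sub_add_cancel i.2.le, hit]
      simp
    refine ⟨hX, ?_⟩
    rw [Z_eq hX]
    apply Nat.dvd_antisymm
    · apply IsPeriodicPt.minimalPeriod_dvd
      change f^[k+1] (e 0) = e 0
      rw [hit]; simp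
    · have := iterate_minimalPeriod (f := f) (x := e 0)
      rw [hit] at this
      have := e.injective this
      exact Nat.dvd_of_mod_eq_zero (by simpa [Fin.ofNat] using congrArg Fin.val this)
  · rintro ⟨f, e⟩ h ⟨f', e'⟩ h' heq
    simp only [Finset.mem_filter, Finset.mem_univ, true_and] at h h'
    simp only [Prod.mk.injEq] at heq ⊢
    obtain ⟨rfl, h0⟩ := heq
    refine ⟨rfl, ?_⟩
    ext i
    have a1 := follow_iter h.2 i
    have a2 := follow_iter h'.2 i
    rw [h0, a2] at a1
    simp only [Fin.ofNat_val_eq_self] at a1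
    rw [a1]
  · rintro ⟨f, v⟩ h
    simp only [Finset.mem_filter, Finset.mem_univ, true_and] at h
    obtain ⟨h1, h2⟩ := h
    rw [Z_eq h1] at h2
    have hinj : Function.Injective (fun i : Fin (k + 1) => f^[(i : ℕ)] v) := by
      intro i j hij
      exact Fin.ext (iterate_injOn_Iio_minimalPeriod (by rw [h2]; exact i.2)
        (by rw [h2]; exact j.2) hij)
    refine ⟨(f, ⟨fun i : Fin (k + 1) => f^[(i : ℕ)] v, hinj⟩), ?_, ?_⟩
    · simp only [Finset.mem_filter, Finset.mem_univ, true_and]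
      constructor
      · intro u
        obtain ⟨s, hs⟩ := h1 u
        refine ⟨s, Finset.mem_map.2 ⟨0, Finset.mem_univ _, ?_⟩⟩
        simpa using (Finset.mem_singleton.1 hs).symm
      · intro i
        have : ((i + 1 : Fin (k+1)) : ℕ) = (i + 1) % minimalPeriod f v := by
          rw [h2]; simp [Fin.val_add]
        simp only [Function.Embedding.coeFn_mk]
        rw [this, iterate_mod_minimalPeriod_eq, Function.iterate_succ_apply']
    · simp

theorem pair_card' (d k : ℕ) :
    (Finset.univ.filter fun p : (Fin d → Fin d) × Fin d => XR {p.2} p.1 ∧ Z p.1 = k + 1).card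
      * (d ^ (k + 1) * d) = d ^ d * (k + 1) * d.descFactorial (k + 1) := by
  rw [pair_card, Finset.card_filter, Fintype.sum_prod_type_right, Finset.sum_mul]
  simp_rw [← Finset.card_filter, follow_card]
  rw [Finset.sum_const, Finset.card_univ, Fintype.card_embedding_eq]
  simp [mul_comm]

theorem Un_fib (d k : ℕ) :
    (Finset.univ.filter fun p : (Fin d → Fin d) × Fin d => XR {p.2} p.1 ∧ Z p.1 = k + 1).card =
    (k + 1) * ((Un d).filter fun f => Z f = k + 1).card := by
  rw [Finset.card_filter, Fintype.sum_prod_type]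
  rw [Un, Finset.filter_filter, Finset.card_filter, Finset.mul_sum]
  refine Finset.sum_congr rfl fun f _ => ?_
  simp only [conn_iff]
  by_cases h : Connected f ∧ Z f = k + 1
  · rw [if_pos h, mul_one, ← h.2, Z, Nat.card_eq_fintype_card, Fintype.card_subtype,
      Finset.card_filter]
    refine Finset.sum_congr rfl fun v _ => ?_
    simp [h.1]
  · rw [if_neg h, mul_zero]
    apply Finset.sum_eq_zero
    intro v _
    rw [if_neg]; tauto

theorem Un_fib_card (d k : ℕ) (hk : k < d) :
    ((((Un d).filter fun f => Z f = k + 1).card : ℕ) : ℝ) * d =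
      (d.factorial : ℝ) * ((d : ℝ) ^ (d - 1 - k) / ((d - 1 - k).factorial : ℝ)) := by
  have h := pair_card' d k
  rw [Un_fib] at h
  have hf := Nat.factorial_mul_descFactorial (n := d) (k := k + 1) hk
  have e : d - (k + 1) = d - 1 - k := by omega
  rw [e] at hf
  have hp : d ^ d = d ^ (k + 1) * d ^ (d - 1 - k) := by rw [← pow_add]; congr 1; omega
  have hd : (d : ℝ) ≠ 0 := by norm_cast; omega
  have hfac : ((d - 1 - k).factorial : ℝ) ≠ 0 := by positivity
  rw [hp] at h
  have h' : (((k + 1 : ℕ) : ℝ)) * (((Un d).filter fun f => Z f = k + 1).card : ℝ) *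
      ((d : ℝ) ^ (k + 1) * d) = (d : ℝ) ^ (k + 1) * (d : ℝ) ^ (d - 1 - k) * ((k + 1 : ℕ) : ℝ) *
      (d.descFactorial (k + 1) : ℝ) := by exact_mod_cast h
  have hf' : ((d - 1 - k).factorial : ℝ) * (d.descFactorial (k + 1) : ℝ) = d.factorial := by
    exact_mod_cast hf
  have hk' : (((k + 1 : ℕ) : ℝ)) ≠ 0 := by positivity
  rw [← hf']
  field_simp
  apply mul_left_cancel₀ (mul_ne_zero hk' (pow_ne_zero (k+1) hd))
  linear_combination h'

theorem Z_pos {d : ℕ} (hd : 0 < d) (f : Fin d → Fin d) : 0 < Z f := by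
  rw [Z, Nat.card_eq_fintype_card, Fintype.card_pos_iff]
  obtain ⟨i, j, hij, h⟩ := Finite.exists_ne_map_eq_of_infinite (fun n : ℕ => f^[n] ⟨0, hd⟩)
  wlog hlt : i < j generalizing i j
  · exact this j i hij.symm h.symm (by omega)
  refine ⟨⟨f^[i] ⟨0, hd⟩, j - i, by omega, ?_⟩⟩
  rw [← Function.iterate_add_apply, Nat.sub_add_cancel hlt.le]
  exact h.symm

theorem Un_card (d : ℕ) (hd : 0 < d) :
    ((Un d).card : ℝ) * d =
      (d.factorial : ℝ) * ∑ k ∈ Finset.range d, (d : ℝ) ^ k / (k.factorial : ℝ) := by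
  rw [← Finset.sum_range_reflect, Finset.mul_sum]
  rw [Finset.card_eq_sum_card_fiberwise (f := fun f => Z f - 1) (t := Finset.range d)]
  · push_cast
    rw [Finset.sum_mul]
    refine Finset.sum_congr rfl fun k hk => ?_
    rw [← Un_fib_card d k (Finset.mem_range.1 hk)]
    congr 3
    refine Finset.filter_congr fun f hf => ?_
    have := Z_pos hd f
    omega
  · intro f _
    have h2 : Z f ≤ d := by
      rw [Z, Nat.card_eq_fintype_card]
      simpa using Fintype.card_subtype_le (fun v => IsCyclic f v)
    simp only [Finset.coe_range, Set.mem_Iio]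
    omega

theorem stirling_upper (n : ℕ) (hn : 0 < n) :
    Real.log (Stirling.stirlingSeq n) - Real.log (√Real.pi) ≤ 1 / n := by
  have hmono : Monotone (fun k : ℕ => Real.log (Stirling.stirlingSeq (k + 1)) - 1 / ((k + 1 : ℕ) : ℝ)) := by
    refine monotone_nat_of_le_succ fun k => ?_
    have h := Stirling.log_stirlingSeq_sdiff_le (k + 1)
    have : (1 : ℝ) / (12 * ((k + 1 : ℕ) : ℝ) * (((k + 1 : ℕ) : ℝ) + 1)) ≤
        1 / ((k + 1 : ℕ) : ℝ) - 1 / ((k + 1 + 1 : ℕ) : ℝ) := by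
      push_cast
      have hk : (0 : ℝ) < (k : ℝ) + 1 := by positivity
      rw [div_sub_div _ _ (by positivity) (by positivity), div_le_div_iff₀ (by positivity) (by positivity)]
      nlinarith [mul_pos hk (by linarith : (0:ℝ) < k + 1 + 1)]
    linarith
  have hl : Filter.Tendsto (fun k : ℕ => Real.log (Stirling.stirlingSeq (k + 1)) - 1 / ((k + 1 : ℕ) : ℝ))
      Filter.atTop (nhds (Real.log (√Real.pi) - 0)) := by
    refine Filter.Tendsto.sub ?_ ?_
    · exact ((Stirling.tendsto_stirlingSeq_sqrt_pi.log (by positivity)).comp (Filter.tendsto_add_atTop_nat 1))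
    · exact (tendsto_one_div_atTop_nhds_zero_nat (𝕜 := ℝ)).comp (Filter.tendsto_add_atTop_nat 1)
  have := hmono.ge_of_tendsto hl (n - 1)
  simp only [Nat.sub_add_cancel hn] at this
  linarith

theorem stirling_inv (n : ℕ) (hn : 0 < n) :
    |1 / Stirling.stirlingSeq n - 1 / √Real.pi| ≤ 1 / n := by
  have hs := Stirling.sqrt_pi_le_stirlingSeq hn.ne'
  have hpi : 1 ≤ √Real.pi := by
    rw [Real.one_le_sqrt]; linarith [Real.pi_gt_three]
  have hpos : 0 < Stirling.stirlingSeq n := by linarith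
  have h := stirling_upper n hn
  rw [← Real.log_div hpos.ne' (by positivity)] at h
  have h2 := Real.one_sub_inv_le_log_of_pos (div_pos hpos (by linarith : 0 < √Real.pi))
  rw [inv_div] at h2
  have h3 : 1 / √Real.pi - 1 / Stirling.stirlingSeq n =
      (1 / √Real.pi) * (1 - √Real.pi / Stirling.stirlingSeq n) := by
    field_simp
  have h4 : 1 / √Real.pi ≤ 1 := by rw [div_le_one (by linarith)]; exact hpi
  have h5 : 0 ≤ 1 - √Real.pi / Stirling.stirlingSeq n := by
    rw [sub_nonneg, div_le_one hpos]; exact hs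
  rw [abs_sub_comm, h3, abs_of_nonneg (by positivity)]
  calc _ ≤ 1 * (1 - √Real.pi / Stirling.stirlingSeq n) := by gcongr
    _ ≤ _ := by linarith

theorem c_eq (d : ℕ) (hd : 0 < d) :
    c d = Real.exp (-(d : ℝ)) * ((d : ℝ) ^ d / d.factorial) -
      Real.exp (-(d : ℝ)) * (∑ k ∈ Finset.range d, (d : ℝ) ^ k / (k.factorial : ℝ)) / d := by
  have h1 := Un_card d hd
  have h2 : ∑ f ∈ Un d, (Z f : ℝ) = (d : ℝ) ^ d := by exact_mod_cast sum_Z d hd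
  have hS : 0 < ∑ k ∈ Finset.range d, (d : ℝ) ^ k / (k.factorial : ℝ) :=
    Finset.sum_pos (fun k _ => by positivity) (by simpa using hd.ne')
  rw [c, kappa, h2]
  set S := ∑ k ∈ Finset.range d, (d : ℝ) ^ k / (k.factorial : ℝ)
  have hd' : (d : ℝ) ≠ 0 := by positivity
  have hU : ((Un d).card : ℝ) = d.factorial * S / d := by field_simp; exact h1
  rw [hU]
  have hf : (d.factorial : ℝ) ≠ 0 := by positivity
  field_simp

/-- `c_d = 1/√(2πd) + O(1/d)`. -/
theorem c_asymp :
    ∃ C : ℝ, ∃ N : ℕ, ∀ d : ℕ, N ≤ d →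
      |c d - 1 / Real.sqrt (2 * Real.pi * d)| ≤ C / d := by
  refine ⟨2, 1, fun d hd => ?_⟩
  have hd0 : (0 : ℝ) < d := by exact_mod_cast hd
  rw [c_eq d hd]
  have hS0 : 0 ≤ ∑ k ∈ Finset.range d, (d : ℝ) ^ k / (k.factorial : ℝ) :=
    Finset.sum_nonneg fun k _ => by positivity
  have hS1 := Real.sum_le_exp_of_nonneg hd0.le d
  set S := ∑ k ∈ Finset.range d, (d : ℝ) ^ k / (k.factorial : ℝ)
  have hB0 : 0 ≤ Real.exp (-(d : ℝ)) * S / d := by positivity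
  have hB1 : Real.exp (-(d : ℝ)) * S / d ≤ 1 / d := by
    gcongr
    calc _ ≤ Real.exp (-(d : ℝ)) * Real.exp d := by gcongr
      _ = 1 := by rw [← Real.exp_add]; simp
  have hA : Real.exp (-(d : ℝ)) * ((d : ℝ) ^ d / d.factorial) =
      (1 / √(2 * d)) * (1 / Stirling.stirlingSeq d) := by
    rw [Stirling.stirlingSeq, div_pow, ← Real.exp_nat_mul, Real.exp_neg, mul_one]
    have : √(2 * (d : ℝ)) ≠ 0 := by positivity
    field_simp
  have hB : 1 / √(2 * Real.pi * d) = (1 / √(2 * d)) * (1 / √Real.pi) := by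
    rw [show 2 * Real.pi * (d : ℝ) = (2 * d) * Real.pi by ring, Real.sqrt_mul (by positivity)]
    field_simp
  have hle : |(1 / √(2 * d)) * (1 / Stirling.stirlingSeq d) - (1 / √(2 * d)) * (1 / √Real.pi)|
      ≤ 1 / d := by
    rw [← mul_sub, abs_mul]
    have hd1 : (1 : ℝ) ≤ d := by exact_mod_cast hd
    have : 1 ≤ √(2 * (d : ℝ)) := by rw [Real.one_le_sqrt]; linarith
    have h1 : |1 / √(2 * (d : ℝ))| ≤ 1 := by
      rw [abs_of_nonneg (by positivity), div_le_one (by linarith)]; exact this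
    calc _ ≤ 1 * (1 / (d : ℝ)) := by
          gcongr
          exact stirling_inv d hd
      _ = _ := one_mul _
  rw [hA, hB]
  rw [abs_le] at hle ⊢
  have : (2 : ℝ) / d = 1 / d + 1 / d := by ring
  rw [this]
  constructor <;> linarith [hle.1, hle.2]

end IterMap
end

section
/- (Arratia–Tavaré) There is a constant c > 0 such that for all integers n ≥ m ≥ 3, the conditional expectation of log B − log T given Z = m satisfies (1/N_{n,m}) · Σ_{f ∈ Ω_n, Z(f)=m} (log B(f) − log T(f)) ≤ c · log m · (log log m)², where N_{n,m} > 0 is the number of f ∈ Ω_n with Z(f) = m. -/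
open scoped Classical
open Function

namespace IterMap

section permpart
open Equiv Equiv.Perm

lemma sum_cycle_le {α : Type} [Fintype α] [DecidableEq α] (G : Multiset ℕ → ℝ)
    (hG : ∀ s, 0 ≤ G s) (c : Perm α) :
    ∑ σ : Perm α with c ∈ σ.cycleFactorsFinset, G ((σ * c⁻¹).cycleType) ≤
      ∑ ρ : Perm {x : α // x ∉ c.support}, G ρ.cycleType := by
  have h1 : ∑ σ : Perm α with c ∈ σ.cycleFactorsFinset, G ((σ * c⁻¹).cycleType) =
      ∑ τ ∈ (Finset.univ.filter fun σ : Perm α => c ∈ σ.cycleFactorsFinset).image (· * c⁻¹),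
        G τ.cycleType := by
    rw [Finset.sum_image]
    intro a _ b _ hab
    exact mul_right_cancel hab
  have h2 : ∑ ρ : Perm {x : α // x ∉ c.support}, G ρ.cycleType =
      ∑ τ ∈ (Finset.univ : Finset (Perm {x : α // x ∉ c.support})).image
        (fun ρ => (ofSubtype ρ : Perm α)), G τ.cycleType := by
    rw [Finset.sum_image]
    · simp [cycleType_ofSubtype]
    · intro a _ b _ hab
      exact ofSubtype_injective hab
  rw [h1, h2]
  apply Finset.sum_le_sum_of_subset_of_nonneg
  · intro τ hτ
    simp only [Finset.mem_image, Finset.mem_filter, Finset.mem_univ, true_and] at hτ ⊢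
    obtain ⟨σ, hσ, rfl⟩ := hτ
    have hd := disjoint_mul_inv_of_mem_cycleFactorsFinset hσ
    have : (σ * c⁻¹) ∈ (ofSubtype : Perm {x : α // x ∉ c.support} →* Perm α).range := by
      rw [mem_range_ofSubtype_iff]
      intro x hx
      have := (disjoint_iff_disjoint_support.1 hd)
      exact Finset.disjoint_left.1 this hx
    obtain ⟨ρ, hρ⟩ := this
    exact ⟨ρ, hρ⟩
  · intros; exact hG _

/-- `hh d m = ∑ 1/j` over multiples `j` of `d` in `[1, m]`. -/
noncomputable def hh (d m : ℕ) : ℝ := ∑ j ∈ Finset.Icc 1 m with d ∣ j, (1 : ℝ) / j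

lemma hh_nonneg (d m : ℕ) : 0 ≤ hh d m := Finset.sum_nonneg fun _ _ => by positivity

lemma hh_mono (d : ℕ) {m m' : ℕ} (h : m ≤ m') : hh d m ≤ hh d m' := by
  apply Finset.sum_le_sum_of_subset_of_nonneg
  · intro j; simp; intros; omega
  · intros; positivity

lemma hh_le (d m : ℕ) (hd : 0 < d) : hh d m ≤ (1 + Real.log m) / d := by
  have h1 : hh d m ≤ ∑ i ∈ Finset.Icc 1 m, (1 : ℝ) / (d * i) := by
    have : ∀ i ∈ Finset.Icc 1 m, (1 : ℝ) / (d * i) = (fun j : ℕ => (1 : ℝ) / j) (d * i) := by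
      intro i _; push_cast; rfl
    rw [Finset.sum_congr rfl this, ← Finset.sum_image (f := fun j : ℕ => (1 : ℝ) / j) (g := fun i => d * i)]
    · apply Finset.sum_le_sum_of_subset_of_nonneg
      · intro j hj
        simp only [Finset.mem_filter, Finset.mem_Icc, Finset.mem_image] at hj ⊢
        obtain ⟨⟨h1, h2⟩, k, rfl⟩ := hj
        refine ⟨k, ⟨?_, ?_⟩, rfl⟩
        · exact Nat.pos_of_mul_pos_left h1
        · exact le_trans (Nat.le_mul_of_pos_left k hd) h2
      · intros; positivity
    · intro a _ b _ hab
      exact Nat.eq_of_mul_eq_mul_left hd hab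
  have h2 : ∑ i ∈ Finset.Icc 1 m, (1 : ℝ) / (d * i) = (harmonic m : ℝ) / d := by
    rw [harmonic_eq_sum_Icc]
    push_cast
    rw [Finset.sum_div]
    refine Finset.sum_congr rfl fun i _ => ?_
    rw [one_div, mul_inv, div_eq_mul_inv, mul_comm]
  rw [h2] at h1
  refine h1.trans ?_
  gcongr
  exact harmonic_le_one_add_log m

lemma card_cycles {α : Type} [Fintype α] [DecidableEq α] {j : ℕ} (hj : 2 ≤ j)
    (hj' : j ≤ Fintype.card α) :
    ((Finset.univ.filter fun c : Perm α => c.IsCycle ∧ c.support.card = j).card : ℝ) *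
      (Fintype.card α - j).factorial = (Fintype.card α).factorial * (1 / j) := by
  have e : (Finset.univ.filter fun c : Perm α => c.IsCycle ∧ c.support.card = j) =
      (Finset.univ.filter fun c : Perm α => c.cycleType = {j}) := by
    ext c
    simp only [Finset.mem_filter, Finset.mem_univ, true_and]
    constructor
    · rintro ⟨h1, h2⟩
      rw [h1.cycleType, h2]
    · intro h
      have h3 : c.IsCycle := card_cycleType_eq_one.1 (by simp [h])
      exact ⟨h3, by rw [← sum_cycleType, h]; simp⟩
  rw [e, card_of_cycleType_singleton hj hj']
  have h1 := Nat.choose_mul_factorial_mul_factorial hj'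
  have h2 : j.factorial = j * (j-1).factorial := (Nat.mul_factorial_pred (by omega)).symm
  rw [h2] at h1
  rw [← h1]
  have : (j : ℝ) ≠ 0 := by positivity
  push_cast
  field_simp

lemma moment {α : Type} [Fintype α] [DecidableEq α] (d : ℕ) (G : Multiset ℕ → ℝ)
    (hG : ∀ s, 0 ≤ G s) (K : ℝ)
    (hK : ∀ c : Perm α, ∑ ρ : Perm {x : α // x ∉ c.support}, G ρ.cycleType ≤
      K * (Fintype.card α - c.support.card).factorial) (hK0 : 0 ≤ K) :
    ∑ σ : Perm α, ∑ c ∈ σ.cycleFactorsFinset with d ∣ c.support.card, G ((σ * c⁻¹).cycleType) ≤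
      (Fintype.card α).factorial * (K * hh d (Fintype.card α)) := by
  calc _ = ∑ c : Perm α with c.IsCycle ∧ d ∣ c.support.card,
        ∑ σ : Perm α with c ∈ σ.cycleFactorsFinset, G ((σ * c⁻¹).cycleType) := by
        apply Finset.sum_comm'
        intro σ c
        simp only [Finset.mem_filter, Finset.mem_univ, true_and]
        constructor
        · rintro ⟨h1, h2⟩
          exact ⟨h1, (mem_cycleFactorsFinset_iff.1 h1).1, h2⟩
        · rintro ⟨h1, _, h2⟩
          exact ⟨h1, h2⟩
    _ ≤ ∑ c : Perm α with c.IsCycle ∧ d ∣ c.support.card,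
          K * (Fintype.card α - c.support.card).factorial :=
        Finset.sum_le_sum fun c _ => (sum_cycle_le G hG c).trans (hK c)
    _ = ∑ j ∈ Finset.Icc 2 (Fintype.card α) with d ∣ j,
          ∑ c ∈ (Finset.univ.filter fun c : Perm α => c.IsCycle ∧ d ∣ c.support.card) with
            c.support.card = j, K * (Fintype.card α - c.support.card).factorial := by
        rw [Finset.sum_fiberwise_of_maps_to]
        intro c hc
        simp only [Finset.mem_filter, Finset.mem_univ, true_and, Finset.mem_Icc] at hc ⊢
        exact ⟨⟨hc.1.two_le_card_support, Finset.card_le_univ _⟩, hc.2⟩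
    _ = ∑ j ∈ Finset.Icc 2 (Fintype.card α) with d ∣ j,
          (Fintype.card α).factorial * (K * (1 / j)) := by
        refine Finset.sum_congr rfl fun j hj => ?_
        simp only [Finset.mem_filter, Finset.mem_Icc] at hj
        have := card_cycles (α := α) hj.1.1 hj.1.2
        rw [mul_left_comm, ← this]
        rw [Finset.sum_congr (g := fun _ => K * ((Fintype.card α - j).factorial : ℝ)) rfl]
        · rw [Finset.sum_const, nsmul_eq_mul, Finset.filter_filter, mul_left_comm]
          congr 3
          congr 1
          ext c
          simp only [Finset.mem_filter, Finset.mem_univ, true_and]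
          constructor
          · rintro ⟨⟨h1, _⟩, h2⟩; exact ⟨h1, h2⟩
          · rintro ⟨h1, h2⟩; exact ⟨⟨h1, h2 ▸ hj.2⟩, h2⟩
        · intro c hc
          rw [(Finset.mem_filter.1 hc).2]
    _ ≤ _ := by
        rw [← Finset.mul_sum, ← Finset.mul_sum]
        gcongr
        apply Finset.sum_le_sum_of_subset_of_nonneg
        · intro j; simp; intros; omega
        · intros; positivity

lemma countP_cycleType {α : Type} [Fintype α] [DecidableEq α] (d : ℕ) (σ : Perm α) :
    σ.cycleType.countP (d ∣ ·) = (σ.cycleFactorsFinset.filter fun c => d ∣ c.support.card).card := by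
  rw [cycleType_def, Multiset.countP_map]
  rfl

lemma card_compl' {α : Type} [Fintype α] [DecidableEq α] (s : Finset α) :
    Fintype.card {x : α // x ∉ s} = Fintype.card α - s.card := by
  rw [Fintype.card_subtype_compl, Fintype.card_coe]

lemma first_moment {α : Type} [Fintype α] [DecidableEq α] (d : ℕ) :
    ∑ σ : Perm α, (σ.cycleType.countP (d ∣ ·) : ℝ) ≤
      (Fintype.card α).factorial * hh d (Fintype.card α) := by
  have := moment (α := α) d (fun _ => 1) (fun _ => zero_le_one) 1 (by
    intro c
    rw [Finset.sum_const, Finset.card_univ, Fintype.card_perm, card_compl']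
    simp) zero_le_one
  simpa [countP_cycleType] using this

lemma second_moment {α : Type} [Fintype α] [DecidableEq α] (d : ℕ) :
    ∑ σ : Perm α, ((σ.cycleType.countP (d ∣ ·) * (σ.cycleType.countP (d ∣ ·) - 1) : ℕ) : ℝ) ≤
      (Fintype.card α).factorial * (hh d (Fintype.card α)) ^ 2 := by
  have := moment (α := α) d (fun s => (s.countP (d ∣ ·) : ℝ)) (fun _ => by positivity)
    (hh d (Fintype.card α)) (by
    intro c
    refine (first_moment d).trans ?_
    rw [card_compl', mul_comm]
    gcongr
    exact hh_mono d (Nat.sub_le _ _)) (hh_nonneg _ _)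
  rw [pow_two]
  refine le_trans (le_of_eq ?_) this
  refine Finset.sum_congr rfl fun σ _ => ?_
  rw [Finset.sum_congr (g := fun _ => ((σ.cycleType.countP (d ∣ ·) - 1 : ℕ) : ℝ)) rfl]
  · rw [Finset.sum_const, nsmul_eq_mul, ← countP_cycleType]
    push_cast
    rfl
  · intro c hc
    obtain ⟨hc, hdc⟩ := Finset.mem_filter.1 hc
    have hd := disjoint_mul_inv_of_mem_cycleFactorsFinset hc
    have e : σ.cycleType = (σ * c⁻¹).cycleType + c.cycleType := by
      rw [← hd.cycleType_mul]; simp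
    have e2 : c.cycleType = {c.support.card} := (mem_cycleFactorsFinset_iff.1 hc).1.cycleType
    rw [e, e2]
    simp [hdc, ← Multiset.cons_zero]

lemma excess_le {α : Type} [Fintype α] [DecidableEq α] (d : ℕ) (hd : 0 < d) :
    ∑ σ : Perm α, ((σ.cycleType.countP (d ∣ ·) - 1 : ℕ) : ℝ) ≤
      (Fintype.card α).factorial * min ((1 + Real.log (Fintype.card α)) / d)
        (((1 + Real.log (Fintype.card α)) / d) ^ 2) := by
  have h0 := hh_nonneg d (Fintype.card α)
  have h1 := hh_le d (Fintype.card α) hd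
  rw [mul_min_of_nonneg _ _ (by positivity)]
  refine le_min ?_ ?_
  · refine le_trans (Finset.sum_le_sum ?_) ((first_moment d).trans ?_)
    · intro σ _
      exact_mod_cast Nat.sub_le _ _
    · gcongr
  · refine le_trans (Finset.sum_le_sum ?_) ((second_moment d).trans ?_)
    · intro σ _
      norm_cast
      rcases Nat.eq_zero_or_pos (σ.cycleType.countP (d ∣ ·)) with h | h
      · simp [h]
      · exact Nat.le_mul_of_pos_left _ h
    · gcongr

end permpart

section numpart

open ArithmeticFunction in
/-- The weighted excess of multiples. -/
noncomputable def Phi (m : ℕ) (s : Multiset ℕ) : ℝ :=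
  ∑ d ∈ Finset.Icc 2 m, vonMangoldt d * ((s.countP (d ∣ ·) - 1 : ℕ) : ℝ)

open ArithmeticFunction in
lemma log_prod_eq (m : ℕ) (s : Multiset ℕ) (h : ∀ a ∈ s, a ≠ 0 ∧ a ≤ m) :
    Real.log (s.prod : ℕ) = ∑ d ∈ Finset.Icc 2 m, vonMangoldt d * (s.countP (d ∣ ·) : ℝ) := by
  induction s using Multiset.induction_on with
  | empty => simp
  | cons a s ih =>
    have ha := h a (Multiset.mem_cons_self a s)
    have hs : ∀ b ∈ s, b ≠ 0 ∧ b ≤ m := fun b hb => h b (Multiset.mem_cons_of_mem hb)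
    have hp : s.prod ≠ 0 := Multiset.prod_ne_zero fun h0 => (hs 0 h0).1 rfl
    rw [Multiset.prod_cons, Nat.cast_mul, Real.log_mul (by exact_mod_cast ha.1)
      (by exact_mod_cast hp), ih hs]
    have : Real.log a = ∑ d ∈ Finset.Icc 2 m, vonMangoldt d * (if d ∣ a then 1 else 0 : ℝ) := by
      rw [← vonMangoldt_sum]
      simp only [mul_ite, mul_one, mul_zero]
      rw [← Finset.sum_filter]
      symm
      apply Finset.sum_subset_zero_on_sdiff
      · intro d hd
        simp only [Finset.mem_filter] at hd
        exact Nat.mem_divisors.2 ⟨hd.2, ha.1⟩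
      · intro d hd
        simp only [Finset.mem_sdiff, Nat.mem_divisors, Finset.mem_filter, Finset.mem_Icc] at hd
        have h1 : d ≤ a := Nat.le_of_dvd (Nat.pos_of_ne_zero ha.1) hd.1.1
        have h2 : d = 0 ∨ d = 1 := by
          by_contra hne
          exact hd.2 ⟨⟨by omega, by omega⟩, hd.1.1⟩
        rcases h2 with rfl | rfl <;> simp
      · intros; rfl
    rw [this, ← Finset.sum_add_distrib]
    refine Finset.sum_congr rfl fun d _ => ?_
    rw [Multiset.countP_cons]
    push_cast
    ring

open ArithmeticFunction in
lemma log_diff_le (m t : ℕ) (s : Multiset ℕ) (h : ∀ a ∈ s, a ≠ 0 ∧ a ≤ m) (ht : t ≠ 0)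
    (hst : ∀ a ∈ s, a ∣ t) :
    Real.log (s.prod : ℕ) - Real.log t ≤ Phi m s := by
  have h1 : ∑ d ∈ Finset.Icc 2 m, vonMangoldt d * (if 0 < s.countP (d ∣ ·) then 1 else 0 : ℝ)
      ≤ Real.log t := by
    rw [← vonMangoldt_sum]
    simp only [mul_ite, mul_one, mul_zero]
    rw [← Finset.sum_filter]
    apply Finset.sum_le_sum_of_subset_of_nonneg
    · intro d hd
      simp only [Finset.mem_filter, Multiset.countP_pos] at hd
      obtain ⟨a, ha, hda⟩ := hd.2
      exact Nat.mem_divisors.2 ⟨hda.trans (hst a ha), ht⟩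
    · intros; exact vonMangoldt_nonneg
  rw [log_prod_eq m s h, Phi]
  have : ∑ d ∈ Finset.Icc 2 m, vonMangoldt d * ((s.countP (d ∣ ·) - 1 : ℕ) : ℝ) =
      ∑ d ∈ Finset.Icc 2 m, vonMangoldt d * (s.countP (d ∣ ·) : ℝ) -
      ∑ d ∈ Finset.Icc 2 m, vonMangoldt d * (if 0 < s.countP (d ∣ ·) then 1 else 0 : ℝ) := by
    rw [← Finset.sum_sub_distrib]
    refine Finset.sum_congr rfl fun d _ => ?_
    split_ifs with h
    · rw [Nat.cast_sub h]; push_cast; ring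
    · simp at h; simp [h]
  linarith

lemma tail_sum (K N : ℕ) (hK : 2 ≤ K) (hN : K ≤ N) :
    ∑ d ∈ Finset.Ioc K N, Real.log d / (d : ℝ) ^ 2 ≤
      (2 + Real.log K) / K - (2 + Real.log N) / N := by
  induction N, hN using Nat.le_induction with
  | base => simp
  | succ n hn ih =>
    rw [← Finset.insert_Ioc_right_eq_Ioc_add_one (by omega), Finset.sum_insert (by simp)]
    have hx : (2 : ℝ) ≤ n := by exact_mod_cast hK.trans hn
    push_cast
    set x : ℝ := (n : ℝ)
    have hl : Real.log (x + 1) ≤ Real.log x + 1 / x := by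
      have : x + 1 = x * (1 + 1 / x) := by field_simp
      rw [this, Real.log_mul (by positivity) (by positivity)]
      have := Real.log_le_sub_one_of_pos (x := 1 + 1 / x) (by positivity)
      linarith
    have hl0 : 0 ≤ Real.log (x + 1) := Real.log_nonneg (by linarith)
    have key : Real.log (x + 1) / (x + 1) ^ 2 ≤
        (2 + (Real.log (x + 1) - 1 / x)) / x - (2 + Real.log (x + 1)) / (x + 1) := by
      set l := Real.log (x + 1)
      have : (2 + (l - 1 / x)) / x - (2 + l) / (x + 1) - l / (x + 1) ^ 2 =
        (l * x + (x + 1) * (x - 1)) / (x ^ 2 * (x + 1) ^ 2) := by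
        field_simp
        ring
      have h2 : 0 ≤ (l * x + (x + 1) * (x - 1)) / (x ^ 2 * (x + 1) ^ 2) := by
        apply div_nonneg _ (by positivity)
        nlinarith
      linarith
    have h3 : (2 + (Real.log (x + 1) - 1 / x)) / x ≤ (2 + Real.log x) / x := by
      gcongr
      linarith
    linarith

lemma num_sum (m : ℕ) (L : ℝ) (hL : 2 ≤ L) :
    ∑ d ∈ Finset.Icc 2 m, Real.log d * min (L / d) ((L / d) ^ 2) ≤
      L * Real.log L * (1 + Real.log L) + 2 * L * (2 + Real.log L) := by
  set K := ⌊L⌋₊ with hKdef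
  have hK : 2 ≤ K := Nat.le_floor (by exact_mod_cast hL)
  have hKL : (K : ℝ) ≤ L := Nat.floor_le (by linarith)
  have hLK : L < K + 1 := Nat.lt_floor_add_one L
  have hKR : (2 : ℝ) ≤ K := by exact_mod_cast hK
  have hlogK : Real.log K ≤ Real.log L := Real.log_le_log (by linarith) hKL
  have hlogL : 0 ≤ Real.log L := Real.log_nonneg (by linarith)
  have hlogK0 : 0 ≤ Real.log K := Real.log_nonneg (by linarith)
  have hsub : ∑ d ∈ Finset.Icc 2 m, Real.log d * min (L / d) ((L / d) ^ 2) ≤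
      ∑ d ∈ Finset.Icc 1 K, (L * Real.log L) * ((d : ℝ)⁻¹) +
      ∑ d ∈ Finset.Ioc K (K + m), L ^ 2 * (Real.log d / (d : ℝ) ^ 2) := by
    rw [← Finset.sum_filter_add_sum_filter_not (Finset.Icc 2 m) (fun d => d ≤ K)]
    apply add_le_add
    · refine le_trans (Finset.sum_le_sum (g := fun d : ℕ => (L * Real.log L) * ((d : ℝ)⁻¹)) ?_)
        (Finset.sum_le_sum_of_subset_of_nonneg ?_ ?_)
      · intro d hd
        simp only [Finset.mem_filter, Finset.mem_Icc] at hd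
        have hd2 : (2 : ℝ) ≤ d := by exact_mod_cast hd.1.1
        have hdK : (d : ℝ) ≤ K := by exact_mod_cast hd.2
        have : Real.log d ≤ Real.log L := Real.log_le_log (by linarith) (by linarith)
        calc Real.log d * min (L / d) ((L / d) ^ 2) ≤ Real.log L * (L / d) := by
              gcongr
              exact min_le_left _ _
          _ = _ := by ring
      · intro d hd
        simp only [Finset.mem_filter, Finset.mem_Icc] at hd ⊢
        omega
      · intros; positivity
    · refine le_trans (Finset.sum_le_sum
        (g := fun d : ℕ => L ^ 2 * (Real.log d / (d : ℝ) ^ 2)) ?_)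
        (Finset.sum_le_sum_of_subset_of_nonneg ?_ ?_)
      · intro d hd
        have : 0 ≤ Real.log d := Real.log_natCast_nonneg d
        calc Real.log d * min (L / d) ((L / d) ^ 2) ≤ Real.log d * ((L / d) ^ 2) := by
              gcongr
              exact min_le_right _ _
          _ = _ := by ring
      · intro d hd
        simp only [Finset.mem_filter, Finset.mem_Icc, Finset.mem_Ioc] at hd ⊢
        omega
      · intro d _ _
        have : 0 ≤ Real.log d := Real.log_natCast_nonneg d
        positivity
  refine hsub.trans (add_le_add ?_ ?_)
  · rw [← Finset.mul_sum]
    gcongr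
    have := harmonic_le_one_add_log K
    rw [harmonic_eq_sum_Icc] at this
    push_cast at this
    linarith
  · rw [← Finset.mul_sum]
    have h1 := tail_sum K (K + m) hK (by omega)
    have h2 : 0 ≤ (2 + Real.log (K + m : ℕ)) / ((K + m : ℕ) : ℝ) := by
      have := Real.log_natCast_nonneg (K + m)
      positivity
    have h3 : (2 + Real.log K) / K ≤ (2 + Real.log L) / (L / 2) := by
      gcongr
      linarith
    calc _ ≤ L ^ 2 * ((2 + Real.log L) / (L / 2)) := by
          gcongr
          linarith
      _ = _ := by
          have : L ≠ 0 := by linarith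
          field_simp

open ArithmeticFunction in
lemma sum_Phi_le {α : Type} [Fintype α] [DecidableEq α] (L : ℝ)
    (hL : L = 1 + Real.log (Fintype.card α)) (hL2 : 2 ≤ L) :
    ∑ σ : Equiv.Perm α, Phi (Fintype.card α) σ.cycleType ≤
      (Fintype.card α).factorial *
        (L * Real.log L * (1 + Real.log L) + 2 * L * (2 + Real.log L)) := by
  unfold Phi
  rw [Finset.sum_comm]
  refine le_trans ?_ (mul_le_mul_of_nonneg_left (num_sum (Fintype.card α) L hL2) (by positivity))
  rw [Finset.mul_sum]
  refine Finset.sum_le_sum fun d hd => ?_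
  rw [← Finset.mul_sum]
  have hd2 := (Finset.mem_Icc.1 hd).1
  have := excess_le (α := α) d (by omega)
  rw [← hL] at this
  have h0 : (0 : ℝ) ≤ ∑ σ : Equiv.Perm α, ((σ.cycleType.countP (d ∣ ·) - 1 : ℕ) : ℝ) :=
    Finset.sum_nonneg fun _ _ => by positivity
  calc _ ≤ Real.log d * ((Fintype.card α).factorial * min (L / d) ((L / d) ^ 2)) :=
        mul_le_mul vonMangoldt_le_log this h0 (Real.log_natCast_nonneg d)
    _ = _ := by ring

lemma one_lt_log3 : (1 : ℝ) < Real.log 3 := by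
  rw [Real.lt_log_iff_exp_lt (by norm_num)]
  exact Real.exp_one_lt_d9.trans (by norm_num)

lemma final_num : ∃ C > (0 : ℝ), ∀ m : ℕ, 3 ≤ m → ∀ L : ℝ, L = 1 + Real.log m →
    L * Real.log L * (1 + Real.log L) + 2 * L * (2 + Real.log L) ≤
      C * Real.log m * (Real.log (Real.log m)) ^ 2 := by
  set a := Real.log (Real.log 3) with ha
  have ha0 : 0 < a := Real.log_pos one_lt_log3
  set A := 1 + 1 / a with hA
  have hA0 : 0 < A := by positivity
  refine ⟨2 * A * (1 / a + A) + 4 * (2 / a + A) / a, by positivity, ?_⟩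
  intro m hm L hL
  have h3 : Real.log 3 ≤ Real.log m := Real.log_le_log (by norm_num) (by exact_mod_cast hm)
  have h1 := one_lt_log3
  set x := Real.log m
  set y := Real.log x
  have hy : a ≤ y := Real.log_le_log (by linarith) h3
  have hL2 : L ≤ 2 * x := by linarith
  have hL0 : 2 < L := by linarith
  have hu : 1 ≤ 1 / a * y := by
    rw [div_mul_eq_mul_div, one_mul]; exact (one_le_div ha0).2 hy
  have hlog2 : Real.log 2 ≤ 1 := by linarith [Real.log_two_lt_d9]
  have hl : Real.log L ≤ A * y := by
    have : Real.log L ≤ Real.log 2 + y := by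
      rw [← Real.log_mul (by norm_num) (by linarith)]
      exact Real.log_le_log (by linarith) hL2
    rw [hA]; linarith
  have hl0 : 0 ≤ Real.log L := Real.log_nonneg (by linarith)
  have hy0 : 0 < y := by linarith
  calc L * Real.log L * (1 + Real.log L) + 2 * L * (2 + Real.log L)
      ≤ (2 * x) * (A * y) * (1 / a * y + A * y) +
          2 * (2 * x) * ((2 * (1 / a * y) + A * y) * (1 / a * y)) := by
        have h5 : 2 + Real.log L ≤ (2 * (1 / a * y) + A * y) * (1 / a * y) := by
          have : 0 ≤ (2 * (1 / a * y) + A * y) := by positivity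
          nlinarith
        gcongr
    _ = _ := by ring

end numpart

section mappart
open Equiv

lemma cyclicPerm_pow {n : ℕ} (f : Fin n → Fin n) (k : ℕ) (v : {v : Fin n // IsCyclic f v}) :
    (((cyclicPerm f) ^ k) v).1 = f^[k] v.1 := by
  induction k with
  | zero => simp
  | succ k ih =>
    rw [pow_succ', Perm.mul_apply, Function.iterate_succ_apply', ← ih]
    rfl

lemma isCyclic_iterate {n : ℕ} {f : Fin n → Fin n} {v : Fin n} (h : IsCyclic f v) (k : ℕ) :
    IsCyclic f (f^[k] v) := by
  induction k with
  | zero => exact h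
  | succ k ih => rw [Function.iterate_succ_apply']; exact isCyclic_apply ih

lemma isCyclic_of_le {n : ℕ} (f : Fin n → Fin n) (v : Fin n) (m : ℕ) (hm : n ≤ m) :
    IsCyclic f (f^[m] v) := by
  have hni : ¬ Function.Injective (fun i : Fin (n + 1) => f^[i.1] v) := by
    intro hi
    have := Fintype.card_le_of_injective _ hi
    simp at this
  obtain ⟨i, j, hij, hlt⟩ : ∃ i j : Fin (n + 1), f^[i.1] v = f^[j.1] v ∧ i < j := by
    simp only [Function.Injective, not_forall] at hni
    obtain ⟨i, j, h1, h2⟩ := hni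
    rcases lt_or_gt_of_ne h2 with h | h
    · exact ⟨i, j, h1, h⟩
    · exact ⟨j, i, h1.symm, h⟩
  have hlt' : i.1 < j.1 := hlt
  have h1 : IsCyclic f (f^[i.1] v) := by
    refine ⟨j.1 - i.1, by omega, ?_⟩
    rw [← Function.iterate_add_apply, Nat.sub_add_cancel hlt'.le, hij]
  have := isCyclic_iterate h1 (m - i.1)
  rwa [← Function.iterate_add_apply, Nat.sub_add_cancel (by omega)] at this

lemma T_spec {n : ℕ} (f : Fin n → Fin n) : T f ≠ 0 ∧ orderOf (cyclicPerm f) ∣ T f := by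
  have hne : {T : ℕ | 0 < T ∧ ∀ m, n ≤ m → f^[m + T] = f^[m]}.Nonempty := by
    refine ⟨orderOf (cyclicPerm f), orderOf_pos _, fun m hm => ?_⟩
    funext v
    rw [add_comm, Function.iterate_add_apply]
    have := cyclicPerm_pow f (orderOf (cyclicPerm f)) ⟨_, isCyclic_of_le f v m hm⟩
    rw [pow_orderOf_eq_one] at this
    exact this.symm
  obtain ⟨h1, h2⟩ : 0 < T f ∧ ∀ m, n ≤ m → f^[m + T f] = f^[m] := Nat.sInf_mem hne
  refine ⟨h1.ne', orderOf_dvd_of_pow_eq_one ?_⟩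
  have : (cyclicPerm f) ^ (n + T f) = (cyclicPerm f) ^ n := by
    ext v
    rw [cyclicPerm_pow, cyclicPerm_pow, h2 n le_rfl]
  rw [pow_add] at this
  exact mul_eq_left.1 this

lemma log_BT_le {n : ℕ} (f : Fin n → Fin n) :
    Real.log (B f) - Real.log (T f) ≤ Phi (Z f) (cyclicPerm f).cycleType := by
  refine log_diff_le _ _ _ ?_ (T_spec f).1 ?_
  · intro a ha
    have h2 := Perm.two_le_of_mem_cycleType ha
    refine ⟨by omega, ?_⟩
    have h3 := Multiset.le_sum_of_mem ha
    have h4 := Perm.sum_cycleType_le (cyclicPerm f)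
    rw [Z, Nat.card_eq_fintype_card]
    omega
  · intro a ha
    exact (Perm.dvd_of_mem_cycleType ha).trans (T_spec f).2

/-- Mappings with cyclic set `p` inducing `σ` there. -/
noncomputable def Fib {n : ℕ} (p : Fin n → Prop) (σ : Perm {v // p v}) : Finset (Fin n → Fin n) :=
  Finset.univ.filter fun f => (∀ v : {v // p v}, f v.1 = (σ v).1) ∧ IsCyclic f = p

/-- Replace the restriction of `f` to `p` by `σ`. -/
noncomputable def repl {n : ℕ} (p : Fin n → Prop) (σ : Perm {v // p v}) (f : Fin n → Fin n) :
    Fin n → Fin n := fun v => if h : p v then (σ ⟨v, h⟩).1 else f v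

lemma repl_iter {n : ℕ} (p : Fin n → Prop) (σ : Perm {v // p v}) (f : Fin n → Fin n) (k : ℕ)
    (v : {v // p v}) : (repl p σ f)^[k] v.1 = ((σ ^ k) v).1 := by
  induction k with
  | zero => simp
  | succ k ih =>
    rw [Function.iterate_succ_apply', ih, pow_succ', Perm.mul_apply, repl, dif_pos ((σ ^ k) v).2]

lemma repl_mem {n : ℕ} (p : Fin n → Prop) (σ : Perm {v // p v}) (f : Fin n → Fin n)
    (hf : IsCyclic f = p) : repl p σ f ∈ Fib p σ := by
  simp only [Fib, Finset.mem_filter, Finset.mem_univ, true_and]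
  refine ⟨fun v => by rw [repl, dif_pos v.2], ?_⟩
  funext v
  apply propext
  constructor
  · rintro ⟨t, ht, hv⟩
    by_contra hp
    have key : ∀ k ≤ t, (repl p σ f)^[k] v = f^[k] v := by
      intro k
      induction k with
      | zero => intro _; rfl
      | succ k ih =>
        intro hk
        have hnp : ¬ p ((repl p σ f)^[k] v) := by
          intro hpk
          apply hp
          have h1 := repl_iter p σ f (t - k) ⟨_, hpk⟩
          simp only at h1
          rw [← Function.iterate_add_apply, Nat.sub_add_cancel (by omega), hv] at h1
          rw [h1]
          exact Subtype.prop _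
        rw [Function.iterate_succ_apply', repl, dif_neg hnp, ih (by omega),
          Function.iterate_succ_apply']
    apply hp
    rw [← hf]
    exact ⟨t, ht, by rw [← key t le_rfl, hv]⟩
  · intro hp
    refine ⟨orderOf σ, orderOf_pos _, ?_⟩
    have := repl_iter p σ f (orderOf σ) ⟨v, hp⟩
    rw [pow_orderOf_eq_one] at this
    exact this

lemma card_Fib_le {n : ℕ} (p : Fin n → Prop) (σ τ : Perm {v // p v}) :
    (Fib p σ).card ≤ (Fib p τ).card := by
  apply Finset.card_le_card_of_injOn (repl p τ)
  · intro f hf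
    exact repl_mem p τ f (Finset.mem_filter.1 hf).2.2
  · intro f hf g hg hfg
    have hf' := (Finset.mem_filter.1 hf).2.1
    have hg' := (Finset.mem_filter.1 hg).2.1
    funext v
    by_cases hp : p v
    · exact (hf' ⟨v, hp⟩).trans (hg' ⟨v, hp⟩).symm
    · have := congrFun hfg v
      simpa [repl, hp] using this

lemma cycleType_Fib {n : ℕ} (p : Fin n → Prop) (σ : Perm {v // p v}) (f : Fin n → Fin n)
    (hf : f ∈ Fib p σ) : (cyclicPerm f).cycleType = σ.cycleType := by
  obtain ⟨h1, h2⟩ := (Finset.mem_filter.1 hf).2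
  subst h2
  have : σ = cyclicPerm f := by
    ext v
    rw [← h1 v]
    rfl
  rw [this]

lemma biUnion_Fib {n : ℕ} (p : Fin n → Prop) :
    (Finset.univ.filter fun f : Fin n → Fin n => IsCyclic f = p) =
      (Finset.univ : Finset (Perm {v // p v})).biUnion (Fib p) := by
  ext f
  simp only [Finset.mem_filter, Finset.mem_univ, true_and, Finset.mem_biUnion]
  constructor
  · intro h
    subst h
    exact ⟨cyclicPerm f, by simp only [Fib, Finset.mem_filter, Finset.mem_univ, true_and, and_true]; intro v; rfl⟩
  · rintro ⟨σ, hσ⟩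
    exact (Finset.mem_filter.1 hσ).2.2

lemma Fib_disj {n : ℕ} (p : Fin n → Prop) (s : Set (Perm {v // p v})) :
    s.PairwiseDisjoint (Fib p) := by
  intro σ _ τ _ hne
  rw [Function.onFun, Finset.disjoint_left]
  intro f hf hg
  apply hne
  ext v
  rw [← (Finset.mem_filter.1 hf).2.1 v, ← (Finset.mem_filter.1 hg).2.1 v]

lemma sum_fixed_p {n m : ℕ} (p : Fin n → Prop) (hm : Fintype.card {v // p v} = m) (R : ℝ)
    (hR : ∑ σ : Perm {v // p v}, Phi m σ.cycleType ≤ m.factorial * R) :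
    ∑ f ∈ Finset.univ.filter fun f : Fin n → Fin n => IsCyclic f = p,
      Phi m (cyclicPerm f).cycleType ≤
    ((Finset.univ.filter fun f : Fin n → Fin n => IsCyclic f = p).card : ℝ) * R := by
  rw [biUnion_Fib, Finset.sum_biUnion (Fib_disj p _), Finset.card_biUnion (Fib_disj p _)]
  have hc : ∀ σ, (Fib p σ).card = (Fib p 1).card := fun σ =>
    le_antisymm (card_Fib_le _ _ _) (card_Fib_le _ _ _)
  have h1 : ∀ σ ∈ (Finset.univ : Finset (Perm {v // p v})),
      ∑ f ∈ Fib p σ, Phi m (cyclicPerm f).cycleType = (Fib p 1).card * Phi m σ.cycleType := by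
    intro σ _
    rw [Finset.sum_congr rfl (g := fun _ => Phi m σ.cycleType)]
    · rw [Finset.sum_const, nsmul_eq_mul, hc]
    · intro f hf
      rw [cycleType_Fib p σ f hf]
  rw [Finset.sum_congr rfl h1, ← Finset.mul_sum]
  simp only [hc, Finset.sum_const, Finset.card_univ, Fintype.card_perm, hm, smul_eq_mul]
  push_cast
  calc _ ≤ ((Fib p 1).card : ℝ) * (m.factorial * R) := by gcongr
    _ = _ := by ring

lemma sum_all {n m : ℕ} (R : ℝ)
    (hR : ∀ p : Fin n → Prop, Fintype.card {v // p v} = m →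
      ∑ σ : Perm {v // p v}, Phi m σ.cycleType ≤ m.factorial * R) :
    ∑ f ∈ Finset.univ.filter fun f : Fin n → Fin n => Z f = m,
      Phi m (cyclicPerm f).cycleType ≤
    ((Finset.univ.filter fun f : Fin n → Fin n => Z f = m).card : ℝ) * R := by
  rw [← Finset.sum_fiberwise (Finset.univ.filter fun f : Fin n → Fin n => Z f = m)
    (fun f => IsCyclic f), Finset.card_eq_sum_card_fiberwise (f := fun f => IsCyclic f)
    (t := Finset.univ) (by intro _ _; simp)]
  push_cast
  rw [Finset.sum_mul]
  refine Finset.sum_le_sum fun p _ => ?_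
  rw [Finset.filter_filter]
  by_cases hp : Fintype.card {v // p v} = m
  · have e : (Finset.univ.filter fun f : Fin n → Fin n => Z f = m ∧ IsCyclic f = p) =
        Finset.univ.filter fun f : Fin n → Fin n => IsCyclic f = p := by
      ext f
      simp only [Finset.mem_filter, Finset.mem_univ, true_and, and_iff_right_iff_imp]
      rintro rfl
      rw [Z, Nat.card_eq_fintype_card, hp]
    rw [e]
    exact sum_fixed_p p hp R (hR p hp)
  · have e : (Finset.univ.filter fun f : Fin n → Fin n => Z f = m ∧ IsCyclic f = p) = ∅ := by
      ext f
      simp only [Finset.mem_filter, Finset.mem_univ, true_and, Finset.notMem_empty, iff_false]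
      rintro ⟨h1, rfl⟩
      rw [Z, Nat.card_eq_fintype_card] at h1
      exact hp h1
    rw [e]
    simp

lemma exists_Z {n m : ℕ} (hm : 3 ≤ m) (hmn : m ≤ n) : ∃ f : Fin n → Fin n, Z f = m := by
  refine ⟨fun v => if v.1 < m then v else ⟨0, by omega⟩, ?_⟩
  set f : Fin n → Fin n := fun v => if v.1 < m then v else ⟨0, by omega⟩ with hf
  have hlt : ∀ v, (f v).1 < m := by
    intro v
    simp only [hf]
    split_ifs with h
    · exact h
    · simp; omega
  have hcyc : ∀ v, IsCyclic f v ↔ v.1 < m := by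
    intro v
    constructor
    · rintro ⟨t, ht, hv⟩
      obtain ⟨k, rfl⟩ : ∃ k, t = k + 1 := ⟨t - 1, by omega⟩
      rw [Function.iterate_succ_apply'] at hv
      rw [← hv]
      exact hlt _
    · intro h
      exact ⟨1, one_pos, by simp [hf, h]⟩
  rw [Z, Nat.card_congr (Equiv.subtypeEquivRight hcyc), Nat.card_eq_fintype_card]
  have e : {v : Fin n // v.1 < m} ≃ Fin m :=
    { toFun := fun v => ⟨v.1.1, v.2⟩
      invFun := fun i => ⟨⟨i.1, by omega⟩, i.2⟩
      left_inv := fun v => rfl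
      right_inv := fun i => rfl }
  rw [Fintype.card_congr e, Fintype.card_fin]

end mappart

/-- Arratia–Tavaré: conditional expectation of `log B - log T` given `Z = m`. -/
theorem arratia_tavare :
    ∃ c > (0 : ℝ), ∀ n m : ℕ, 3 ≤ m → m ≤ n →
      0 < (Finset.univ.filter fun f : Fin n → Fin n => Z f = m).card ∧
      (∑ f ∈ Finset.univ.filter fun f : Fin n → Fin n => Z f = m,
          (Real.log (B f) - Real.log (T f))) /
          ((Finset.univ.filter fun f : Fin n → Fin n => Z f = m).card : ℝ) ≤
        c * Real.log m * (Real.log (Real.log m)) ^ 2 := by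
  obtain ⟨C, hC, hC'⟩ := final_num
  refine ⟨C, hC, fun n m hm hmn => ?_⟩
  have hpos : 0 < (Finset.univ.filter fun f : Fin n → Fin n => Z f = m).card := by
    obtain ⟨f, hf⟩ := exists_Z hm hmn
    exact Finset.card_pos.2 ⟨f, by simp [hf]⟩
  refine ⟨hpos, ?_⟩
  rw [div_le_iff₀ (by exact_mod_cast hpos)]
  have hL2 : (2 : ℝ) ≤ 1 + Real.log m := by
    have h3 : Real.log 3 ≤ Real.log m := Real.log_le_log (by norm_num) (by exact_mod_cast hm)
    linarith [one_lt_log3]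
  have hall := sum_all (n := n) (m := m) _ (by
    intro p hp
    have := sum_Phi_le (α := {v // p v}) (1 + Real.log m) (by rw [hp]) hL2
    rw [hp] at this
    exact this)
  have h1 : ∑ f ∈ Finset.univ.filter fun f : Fin n → Fin n => Z f = m,
      (Real.log (B f) - Real.log (T f)) ≤
      ∑ f ∈ Finset.univ.filter fun f : Fin n → Fin n => Z f = m,
      Phi m (cyclicPerm f).cycleType := by
    refine Finset.sum_le_sum fun f hf => ?_
    have := log_BT_le f
    rwa [(Finset.mem_filter.1 hf).2] at this
  refine (h1.trans hall).trans ?_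
  rw [mul_comm]
  gcongr
  exact hC' m hm _ rfl


end IterMap
end
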